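/- Let x ∈ (0, (3√2 - 2)/14). Then 1 - 4x - 14x² > 0, and the point y_crit = (√(x - 6x³ + 4x⁴) + 2x + 2x²)/(1 - 4x - 14x²) is positive and satisfies f_x(y_crit) = 4/3 - (4/3)√(x - 6x³ + 4x⁴) - 2x + (8/3)x², where f_x(y) = (2/3)·(-x + (2-7x)y + (3-6x)y²)/(y + (2+2x)y²). -/

import Mathlib

/-- For `0 < x < (3√2 - 2)/14`: `1 - 4x - 14x² > 0`, the critical point
`y_crit = (√(x - 6x³ + 4x⁴) + 2x + 2x²)/(1 - 4x - 14x²)` is positive, and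
`f_x(y_crit) = 4/3 - (4/3)√(x - 6x³ + 4x⁴) - 2x + (8/3)x²`, where
`f_x(y) = (2/3)(-x + (2-7x)y + (3-6x)y²)/(y + (2+2x)y²)`. -/
theorem fx_critical_value (x : ℝ) (hx0 : 0 < x)
    (hx1 : x < (3 * Real.sqrt 2 - 2) / 14) :
    0 < 1 - 4 * x - 14 * x ^ 2 ∧
    0 < (Real.sqrt (x - 6 * x ^ 3 + 4 * x ^ 4) + 2 * x + 2 * x ^ 2) /
        (1 - 4 * x - 14 * x ^ 2) ∧
    (2 / 3) * ((-x + (2 - 7 * x) *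
          ((Real.sqrt (x - 6 * x ^ 3 + 4 * x ^ 4) + 2 * x + 2 * x ^ 2) /
            (1 - 4 * x - 14 * x ^ 2)) + (3 - 6 * x) *
          ((Real.sqrt (x - 6 * x ^ 3 + 4 * x ^ 4) + 2 * x + 2 * x ^ 2) /
            (1 - 4 * x - 14 * x ^ 2)) ^ 2) /
        (((Real.sqrt (x - 6 * x ^ 3 + 4 * x ^ 4) + 2 * x + 2 * x ^ 2) /
            (1 - 4 * x - 14 * x ^ 2)) + (2 + 2 * x) *
          ((Real.sqrt (x - 6 * x ^ 3 + 4 * x ^ 4) + 2 * x + 2 * x ^ 2) /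
            (1 - 4 * x - 14 * x ^ 2)) ^ 2)) =
      4 / 3 - (4 / 3) * Real.sqrt (x - 6 * x ^ 3 + 4 * x ^ 4) - 2 * x +
        (8 / 3) * x ^ 2 := by
  have h2 : Real.sqrt 2 ^ 2 = 2 := Real.sq_sqrt (by norm_num)
  have h2p : 0 ≤ Real.sqrt 2 := Real.sqrt_nonneg 2
  have hQ : 0 < 1 - 4 * x - 14 * x ^ 2 := by
    nlinarith [mul_pos (show 0 < 3 * Real.sqrt 2 - 2 - 14 * x by linarith)
      (show 0 < 3 * Real.sqrt 2 + 2 + 14 * x by linarith)]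
  have hx4 : x < 1 / 4 := by nlinarith [sq_nonneg x]
  have hr : 0 ≤ x - 6 * x ^ 3 + 4 * x ^ 4 := by
    have h1 : 0 ≤ 1 - 6 * x ^ 2 + 4 * x ^ 3 := by
      nlinarith [pow_pos hx0 3]
    nlinarith [mul_nonneg hx0.le h1]
  have hs := Real.sq_sqrt hr
  have hs0 := Real.sqrt_nonneg (x - 6 * x ^ 3 + 4 * x ^ 4)
  generalize Real.sqrt (x - 6 * x ^ 3 + 4 * x ^ 4) = s at *
  have hy : 0 < (s + 2 * x + 2 * x ^ 2) / (1 - 4 * x - 14 * x ^ 2) := by positivity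
  refine ⟨hQ, hy, ?_⟩
  have hys : (s + 2 * x + 2 * x ^ 2) / (1 - 4 * x - 14 * x ^ 2) * (1 - 4 * x - 14 * x ^ 2)
      = s + 2 * x + 2 * x ^ 2 := div_mul_cancel₀ _ hQ.ne'
  generalize (s + 2 * x + 2 * x ^ 2) / (1 - 4 * x - 14 * x ^ 2) = y at *
  have hse : s = y * (1 - 4 * x - 14 * x ^ 2) - 2 * x - 2 * x ^ 2 := by linarith
  have hq : (1 - 4 * x - 14 * x ^ 2) * y ^ 2 - (4 * x + 4 * x ^ 2) * y - x = 0 := by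
    apply mul_left_cancel₀ hQ.ne'
    rw [hse] at hs
    linear_combination hs
  have hD : 0 < y + (2 + 2 * x) * y ^ 2 := by positivity
  have hN : -x + (2 - 7 * x) * y + (3 - 6 * x) * y ^ 2
      = (2 - 2 * s - 3 * x + 4 * x ^ 2) * (y + (2 + 2 * x) * y ^ 2) := by
    rw [hse]
    linear_combination (2 * (2 + 2 * x) * y + 1) * hq
  rw [hN, mul_div_cancel_right₀ _ hD.ne']
  ring
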